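/- The supremum over ρ_1, ρ_2 ≥ 0 and w ∈ [-1,1] of e^{-(ρ_1²+ρ_2²)/2} · (1 - Φ((ρ_2 - ρ_1 w)/√(1-w²))) · (1 - Φ((ρ_1 - ρ_2 w)/√(1-w²))) · √(1-w²) equals 1/4. -/

import Mathlib

/-- The standard Gaussian density `φ`. -/
noncomputable def gaussPdf (y : ℝ) : ℝ := (Real.sqrt (2 * Real.pi))⁻¹ * Real.exp (-y ^ 2 / 2)

/-- The standard Gaussian CDF `Φ`. -/
noncomputable def gaussCdf (y : ℝ) : ℝ := ∫ s in Set.Iic y, gaussPdf s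

theorem gaussPdf_nonneg (y : ℝ) : 0 ≤ gaussPdf y := by
  unfold gaussPdf; positivity

theorem gaussPdf_neg (y : ℝ) : gaussPdf (-y) = gaussPdf y := by
  simp [gaussPdf]

theorem gaussPdf_eq_gaussianPDFReal : gaussPdf = ProbabilityTheory.gaussianPDFReal 0 1 := by
  ext y
  simp [gaussPdf, ProbabilityTheory.gaussianPDFReal]

theorem integrable_gaussPdf : MeasureTheory.Integrable gaussPdf := by
  rw [gaussPdf_eq_gaussianPDFReal]
  exact ProbabilityTheory.integrable_gaussianPDFReal 0 1

theorem integral_gaussPdf : ∫ y, gaussPdf y = 1 := by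
  rw [gaussPdf_eq_gaussianPDFReal]
  exact ProbabilityTheory.integral_gaussianPDFReal_eq_one 0 one_ne_zero

theorem gaussCdf_neg (y : ℝ) : gaussCdf (-y) = 1 - gaussCdf y := by
  have h_tail : gaussCdf (-y) = ∫ s in Set.Ioi y, gaussPdf s := by
    have h := integral_comp_neg_Iic (-y) gaussPdf
    simpa only [gaussCdf, gaussPdf_neg, neg_neg] using h
  have h_add := MeasureTheory.integral_add_compl (measurableSet_Iic (a := y)) integrable_gaussPdf
  rw [Set.compl_Iic, ← h_tail, integral_gaussPdf] at h_add
  unfold gaussCdf at *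
  linarith

theorem gaussCdf_mono : Monotone gaussCdf := fun _ _ h =>
  MeasureTheory.setIntegral_mono_set integrable_gaussPdf.integrableOn
    (Filter.Eventually.of_forall gaussPdf_nonneg) (Set.Iic_subset_Iic.2 h).eventuallyLE

theorem gaussCdf_nonneg (y : ℝ) : 0 ≤ gaussCdf y :=
  MeasureTheory.integral_nonneg gaussPdf_nonneg

theorem gaussCdf_zero : gaussCdf 0 = 1 / 2 := by
  have h := gaussCdf_neg 0
  rw [neg_zero] at h
  linarith

theorem gaussCdf_le_one (y : ℝ) : gaussCdf y ≤ 1 := by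
  linarith [gaussCdf_neg y, gaussCdf_nonneg (-y)]

/-- If `0 ≤ a + b`, the two upper Gaussian tails sum to at most one. -/
theorem gaussian_tail_mul_tail_le {a b : ℝ} (h : 0 ≤ a + b) :
    (1 - gaussCdf a) * (1 - gaussCdf b) ≤ 1 / 4 := by
  have h_mono : gaussCdf (-b) ≤ gaussCdf a := gaussCdf_mono (by linarith)
  rw [gaussCdf_neg] at h_mono
  nlinarith [gaussCdf_le_one a, gaussCdf_le_one b, sq_nonneg (gaussCdf a - gaussCdf b)]

/-- The supremum over `ρ₁, ρ₂ ≥ 0`, `w ∈ [-1,1]` of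
`e^{-(ρ₁²+ρ₂²)/2} (1-Φ((ρ₂-ρ₁w)/√(1-w²))) (1-Φ((ρ₁-ρ₂w)/√(1-w²))) √(1-w²)` equals `1/4`. -/
theorem stmt17 :
    sSup {z : ℝ | ∃ ρ₁ ρ₂ w : ℝ, 0 ≤ ρ₁ ∧ 0 ≤ ρ₂ ∧ w ∈ Set.Icc (-1 : ℝ) 1 ∧
        z = Real.exp (-(ρ₁ ^ 2 + ρ₂ ^ 2) / 2) *
          (1 - gaussCdf ((ρ₂ - ρ₁ * w) / Real.sqrt (1 - w ^ 2))) *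
          (1 - gaussCdf ((ρ₁ - ρ₂ * w) / Real.sqrt (1 - w ^ 2))) *
          Real.sqrt (1 - w ^ 2)} = 1 / 4 := by
  refine IsGreatest.csSup_eq ⟨⟨0, 0, 0, le_rfl, le_rfl, by norm_num, ?_⟩, ?_⟩
  · simp only [zero_mul, sub_zero, zero_div, gaussCdf_zero]
    norm_num
  · rintro z ⟨ρ₁, ρ₂, w, h₁, h₂, ⟨-, hw⟩, rfl⟩
    have h_sum : 0 ≤ (ρ₂ - ρ₁ * w) / Real.sqrt (1 - w ^ 2) +
        (ρ₁ - ρ₂ * w) / Real.sqrt (1 - w ^ 2) := by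
      rw [← add_div]
      exact div_nonneg (by nlinarith) (Real.sqrt_nonneg _)
    have h_tails := gaussian_tail_mul_tail_le h_sum
    have h_sqrt : Real.sqrt (1 - w ^ 2) ≤ 1 := Real.sqrt_le_one.2 (by nlinarith [sq_nonneg w])
    have h_exp : Real.exp (-(ρ₁ ^ 2 + ρ₂ ^ 2) / 2) ≤ 1 :=
      Real.exp_le_one_iff.2 (by nlinarith [sq_nonneg ρ₁, sq_nonneg ρ₂])
    have h_nonneg := mul_nonneg
      (sub_nonneg.2 (gaussCdf_le_one ((ρ₂ - ρ₁ * w) / Real.sqrt (1 - w ^ 2))))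
      (sub_nonneg.2 (gaussCdf_le_one ((ρ₁ - ρ₂ * w) / Real.sqrt (1 - w ^ 2))))
    rw [mul_assoc (Real.exp _)]
    refine (mul_le_of_le_one_right (mul_nonneg (Real.exp_nonneg _) h_nonneg) h_sqrt).trans ?_
    exact (mul_le_of_le_one_left h_nonneg h_exp).trans h_tails
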